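/- For every single-site operator O (a d×d complex matrix), every site i ∈ {0,…,L−1}, and every integer k ≥ 0, one has Tr(T^k · O_i) = d^{gcd(k,L)−1} · Tr(O), where O_i denotes O acting on site i tensored with the identity on all other sites and gcd(0,L) = L. -/

import Mathlib

open scoped BigOperators

noncomputable section

/-- Cyclic shift by one site: `(shift σ) i = σ (i - 1)`. -/
def shift (d L : ℕ) (σ : ZMod L → Fin d) : ZMod L → Fin d := fun i => σ (i - 1)

/-- The translation operator `T` on `H = (ℂ^d)^{⊗L}`. -/
def Tmat (d L : ℕ) [NeZero L] : Matrix (ZMod L → Fin d) (ZMod L → Fin d) ℂ :=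
  Matrix.of fun τ σ => if τ = shift d L σ then 1 else 0

/-- The operator `O_i`: a single-site operator `O` acting on site `i`, tensored with
the identity on all other sites. -/
def siteOp (d L : ℕ) [NeZero L] (O : Matrix (Fin d) (Fin d) ℂ) (i : ZMod L) :
    Matrix (ZMod L → Fin d) (ZMod L → Fin d) ℂ :=
  Matrix.of fun τ σ => O (τ i) (σ i) * if (∀ j, j ≠ i → τ j = σ j) then 1 else 0

theorem Tmat_pow_apply (d L : ℕ) [NeZero L] (k : ℕ) (τ σ : ZMod L → Fin d) :
    (Tmat d L ^ k) τ σ = if τ = fun j => σ (j - k) then 1 else 0 := by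
  induction k generalizing τ σ with
  | zero => simp [Matrix.one_apply]
  | succ k ih =>
    rw [pow_succ, Matrix.mul_apply]
    rw [Fintype.sum_eq_single (shift d L σ) fun ρ hρ => by simp [Tmat, hρ], ih]
    simp [Tmat, shift, sub_sub]

/-- If a permuted function agrees with the original away from one point, it agrees there too. -/
theorem eq_apply_of_forall_ne {α : Type*} [Fintype α] {d : ℕ} (e : Equiv.Perm α)
    (σ : α → Fin d) (i : α) (h : ∀ j, j ≠ i → σ j = σ (e j)) : σ i = σ (e i) := by
  have hsum : ∑ j, ((σ j : ℤ) - (σ (e j) : ℤ)) = 0 := by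
    rw [Finset.sum_sub_distrib, Equiv.sum_comp e (fun j => (σ j : ℤ)), sub_self]
  rw [Fintype.sum_eq_single i (fun j hj => by rw [← h j hj, sub_self])] at hsum
  exact Fin.ext (by omega)

theorem index_zmultiples_natCast (L : ℕ) [NeZero L] (k : ℕ) :
    (AddSubgroup.zmultiples (k : ZMod L)).index = Nat.gcd k L := by
  have h := (AddSubgroup.zmultiples (k : ZMod L)).card_mul_index
  rw [Nat.card_zmultiples, ZMod.addOrderOf_coe _ (NeZero.ne L), Nat.card_zmod] at h
  have hL : 0 < L := Nat.pos_of_neZero L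
  have hg : L / L.gcd k * L.gcd k = L := Nat.div_mul_cancel (Nat.gcd_dvd_left _ _)
  rw [Nat.gcd_comm k L]
  refine Nat.eq_of_mul_eq_mul_left ?_ (h.trans hg.symm)
  exact Nat.pos_of_ne_zero fun h0 => by simp [h0] at hg; omega

theorem sum_apply_eq_card_pow_mul_sum {Q β : Type*} [Fintype Q] [DecidableEq Q] [Fintype β]
    (q : Q) (g : β → ℂ) :
    ∑ f : Q → β, g (f q) = (Fintype.card β : ℂ) ^ (Fintype.card Q - 1) * ∑ b, g b := by
  classical
  rw [Fintype.sum_equiv (Equiv.funSplitAt q β) (fun f => g (f q)) (fun p => g p.1)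
    (fun f => by simp [Equiv.funSplitAt]), Fintype.sum_prod_type]
  simp [Finset.mul_sum, Fintype.card_subtype_compl]

theorem sum_filter_periodic {A β : Type*} [AddCommGroup A] [Fintype A]
    [DecidableEq A] [Fintype β] [DecidableEq β] (a : A)
    [Fintype (A ⧸ AddSubgroup.zmultiples a)] [DecidableEq (A ⧸ AddSubgroup.zmultiples a)]
    (F : (A → β) → ℂ) :
    ∑ σ : A → β with ∀ j, σ j = σ (j - a), F σ =
      ∑ f : A ⧸ AddSubgroup.zmultiples a → β, F fun j => f j := by
  symm
  refine Finset.sum_bij (fun f _ j => f j) ?_ ?_ ?_ fun _ _ => rfl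
  · intro f _
    simp only [Finset.mem_filter_univ]
    intro j
    congr 1
    rw [QuotientAddGroup.eq]
    simp [sub_eq_add_neg]
  · intro f _ g _ h
    funext x
    obtain ⟨j, rfl⟩ := QuotientAddGroup.mk_surjective x
    exact congrFun h j
  · intro σ hσ
    have hper : Function.Periodic σ a := fun j => by
      simpa using (Finset.mem_filter.mp hσ).2 (j + a)
    exact ⟨hper.lift, Finset.mem_univ _, funext fun j => hper.lift_coe j⟩

/-- for every single-site operator `O`, site `i`, and integer `k ≥ 0`,
`Tr(T^k · O_i) = d^{gcd(k,L)−1} · Tr(O)` (with `gcd(0,L) = L`). -/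
theorem stmt13 (d L : ℕ) [NeZero L] (hd : 2 ≤ d) (hL : 1 ≤ L)
    (O : Matrix (Fin d) (Fin d) ℂ) (i : ZMod L) (k : ℕ) :
    ((Tmat d L ^ k) * siteOp d L O i).trace
      = (d : ℂ) ^ (Nat.gcd k L - 1) * O.trace := by
  classical
  have hmain : ((Tmat d L ^ k) * siteOp d L O i).trace =
      ∑ σ : ZMod L → Fin d with ∀ j, σ j = σ (j - k), O (σ i) (σ i) := by
    rw [Matrix.trace, Finset.sum_filter]
    simp only [Matrix.diag_apply, Matrix.mul_apply, Tmat_pow_apply]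
    rw [Finset.sum_comm]
    refine Finset.sum_congr rfl fun σ _ => ?_
    simp only [ite_mul, one_mul, zero_mul, Finset.sum_ite_eq', Finset.mem_univ, if_true,
      siteOp, Matrix.of_apply]
    have hiff : (∀ j, j ≠ i → σ j = σ (j - k)) ↔ ∀ j, σ j = σ (j - k) := by
      refine ⟨fun h j => ?_, fun h j _ => h j⟩
      by_cases hj : j = i
      · subst hj
        exact eq_apply_of_forall_ne (Equiv.subRight (k : ZMod L)) σ j h
      · exact h j hj
    by_cases h : ∀ j, σ j = σ (j - k)
    · rw [if_pos (hiff.mpr h), if_pos h, mul_one, ← h i]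
    · rw [if_neg (mt hiff.mp h), if_neg h, mul_zero]
  rw [hmain, sum_filter_periodic (k : ZMod L) (fun σ => O (σ i) (σ i)),
    sum_apply_eq_card_pow_mul_sum (i : ZMod L ⧸ AddSubgroup.zmultiples (k : ZMod L))
      (fun b => O b b), ← Nat.card_eq_fintype_card (α := ZMod L ⧸ _),
    ← AddSubgroup.index_eq_card, index_zmultiples_natCast, Fintype.card_fin]
  rfl
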